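/- arXiv:1910.06083 — 3 statements merged into one kernel-verified Lean document; each statement's English description precedes it below -/
import Mathlib

section
/- Let L/K be a finite Galois extension with Galois group G, let J be a normal subgroup of G and G' a subgroup of G that is a complement of J, and let E = L^{G'}, F = L^{J}. Then E and F are linearly disjoint over K and L = EF; more precisely, the K-algebra homomorphism E ⊗_K F → L induced by multiplication (x ⊗ y ↦ xy) is bijective. -/
open IntermediateField

/-- For a finite Galois extension `L/K` with Galois group `G`, a normal subgroup `J`
and a complement `G'` of `J`, the fixed fields `E = L^{G'}` and `F = L^J` are
linearly disjoint over `K` with `EF = L`: the multiplication map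
`E ⊗[K] F → L`, `x ⊗ y ↦ xy`, is bijective. -/
theorem stmt1 {K L : Type*} [Field K] [Field L] [Algebra K L]
    [FiniteDimensional K L] [IsGalois K L]
    (J G' : Subgroup (L ≃ₐ[K] L)) [J.Normal]
    (hcomp : Subgroup.IsComplement' J G') :
    fixedField G' ⊔ fixedField J = ⊤ ∧
    Function.Bijective
      (Algebra.TensorProduct.productMap (fixedField G').val (fixedField J).val) := by
  have hsup : fixedField G' ⊔ fixedField J = ⊤ := by
    rw [← IsGalois.fixedField_fixingSubgroup (fixedField G' ⊔ fixedField J),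
      fixingSubgroup_sup, fixingSubgroup_fixedField, fixingSubgroup_fixedField,
      inf_comm, hcomp.disjoint.eq_bot, fixedField_bot]
  refine ⟨hsup, ?_⟩
  have hsurj : Function.Surjective
      (Algebra.TensorProduct.productMap (fixedField G').val (fixedField J).val) := by
    rw [← AlgHom.range_eq_top, Algebra.TensorProduct.productMap_range,
      IntermediateField.range_val, IntermediateField.range_val,
      ← IntermediateField.sup_toSubalgebra_of_left, hsup, IntermediateField.top_toSubalgebra]
  have hfin : Module.finrank K (TensorProduct K (fixedField G') (fixedField J)) =
      Module.finrank K L := by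
    rw [Module.finrank_tensorProduct]
    have hE := Module.finrank_mul_finrank K (fixedField G') L
    have hF := Module.finrank_mul_finrank K (fixedField J) L
    rw [finrank_fixedField_eq_card] at hE hF
    have hc := hcomp.card_mul
    rw [IsGalois.card_aut_eq_finrank] at hc
    have hpos : 0 < Module.finrank K L := Module.finrank_pos
    apply Nat.eq_of_mul_eq_mul_right hpos
    calc _ = (Module.finrank K (fixedField G') * Nat.card G') *
          (Module.finrank K (fixedField J) * Nat.card J) := by rw [← hc]; ring
      _ = _ := by rw [hE, hF]
  exact ⟨(LinearMap.injective_iff_surjective_of_finrank_eq_finrank hfin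
    (f := (Algebra.TensorProduct.productMap (fixedField G').val
      (fixedField J).val).toLinearMap)).2 hsurj, hsurj⟩
end

section
/- Let O_K be a principal ideal domain with field of fractions K. Suppose M_1 ∈ Mat_{a×r}(K) and U_1 ∈ GL_a(O_K) are such that U_1·M_1 equals the a × r matrix whose first r rows form a matrix D_1 ∈ GL_r(K) and whose remaining a − r rows are zero, and suppose M_2 ∈ Mat_{b×u}(K) and U_2 ∈ GL_b(O_K) are such that U_2·M_2 equals the b × u matrix whose first u rows form D_2 ∈ GL_u(K) and whose remaining b − u rows are zero. Then D_1 ⊗ D_2 ∈ GL_{ru}(K), and there exists W ∈ GL_{ab}(O_K) such that W·(M_1 ⊗ M_2) equals the ab × ru matrix whose first ru rows form D_1 ⊗ D_2 and whose remaining ab − ru rows are zero. -/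
open Kronecker

/-- If `U₁·M₁` consists of an invertible block `D₁` on top of a zero block, with
`U₁` unimodular over `O_K`, and similarly `U₂·M₂ = (D₂ over 0)` with `U₂`
unimodular, then `D₁ ⊗ D₂` is invertible and there is a unimodular `W` over
`O_K` such that `W·(M₁ ⊗ M₂)` consists of the block `D₁ ⊗ D₂` (in the rows
indexed by the top blocks) with all remaining rows zero. -/
theorem stmt11 {O_K K : Type*} [CommRing O_K] [IsDomain O_K] [IsPrincipalIdealRing O_K]
    [Field K] [Algebra O_K K] [IsFractionRing O_K K]
    {r s u t : ℕ}
    (M₁ : Matrix (Fin r ⊕ Fin s) (Fin r) K)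
    (U₁ : Matrix (Fin r ⊕ Fin s) (Fin r ⊕ Fin s) O_K) (hU₁ : IsUnit U₁.det)
    (D₁ : Matrix (Fin r) (Fin r) K) (hD₁ : IsUnit D₁)
    (h₁ : U₁.map (algebraMap O_K K) * M₁ = Matrix.fromRows D₁ 0)
    (M₂ : Matrix (Fin u ⊕ Fin t) (Fin u) K)
    (U₂ : Matrix (Fin u ⊕ Fin t) (Fin u ⊕ Fin t) O_K) (hU₂ : IsUnit U₂.det)
    (D₂ : Matrix (Fin u) (Fin u) K) (hD₂ : IsUnit D₂)
    (h₂ : U₂.map (algebraMap O_K K) * M₂ = Matrix.fromRows D₂ 0) :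
    IsUnit (D₁ ⊗ₖ D₂) ∧
    ∃ W : Matrix ((Fin r ⊕ Fin s) × (Fin u ⊕ Fin t))
        ((Fin r ⊕ Fin s) × (Fin u ⊕ Fin t)) O_K,
      IsUnit W.det ∧
      (∀ (i : Fin r) (k : Fin u) (c : Fin r × Fin u),
        (W.map (algebraMap O_K K) * (M₁ ⊗ₖ M₂)) (Sum.inl i, Sum.inl k) c =
          (D₁ ⊗ₖ D₂) (i, k) c) ∧
      ∀ (p : (Fin r ⊕ Fin s) × (Fin u ⊕ Fin t)) (c : Fin r × Fin u),
        (∀ (i : Fin r) (k : Fin u), p ≠ (Sum.inl i, Sum.inl k)) →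
        (W.map (algebraMap O_K K) * (M₁ ⊗ₖ M₂)) p c = 0 := by
  have key : (U₁ ⊗ₖ U₂).map (algebraMap O_K K) * (M₁ ⊗ₖ M₂) =
      (Matrix.fromRows D₁ 0 : Matrix (Fin r ⊕ Fin s) (Fin r) K) ⊗ₖ
        (Matrix.fromRows D₂ 0 : Matrix (Fin u ⊕ Fin t) (Fin u) K) := by
    rw [← h₁, ← h₂, Matrix.mul_kronecker_mul]
    congr 1
    ext ⟨i, k⟩ ⟨j, l⟩
    simp [Matrix.kroneckerMap_apply]
  refine ⟨?_, U₁ ⊗ₖ U₂, ?_, ?_, ?_⟩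
  · rw [Matrix.isUnit_iff_isUnit_det] at hD₁ hD₂ ⊢
    rw [Matrix.det_kronecker]
    exact (hD₁.pow _).mul (hD₂.pow _)
  · rw [Matrix.det_kronecker]
    exact (hU₁.pow _).mul (hU₂.pow _)
  · intro i k c
    rw [key]
    simp [Matrix.kroneckerMap_apply]
  · rintro ⟨i | i, k | k⟩ c hp
    · exact absurd rfl (hp i k)
    all_goals
      rw [key]
      simp [Matrix.kroneckerMap_apply]
end

section
/- Let O_K be a principal ideal domain with field of fractions K. Let M_1 ∈ Mat_{a×r}(K) have rank r and M_2 ∈ Mat_{b×u}(K) have rank u. Define Λ_1 = {v ∈ K^r : M_1·v ∈ O_K^a}, Λ_2 = {w ∈ K^u : M_2·w ∈ O_K^b}, and Λ = {x ∈ K^{r·u} (indexed by pairs (j,l), 1 ≤ j ≤ r, 1 ≤ l ≤ u) : (M_1 ⊗ M_2)·x ∈ O_K^{a·b}}. Then Λ equals the O_K-submodule of K^{r·u} generated by the elementary tensors v ⊗ w with v ∈ Λ_1 and w ∈ Λ_2, where (v ⊗ w)_{(j,l)} = v_j·w_l. (This is the matrix form of the statement that for an induced Hopf Galois structure H = H_1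 ⊗_K H̄ with arithmetically disjoint inducing subextensions, the associated order satisfies 𝔄_H = 𝔄_{H_1} ⊗_{O_K} 𝔄_{H̄}.) -/
open Kronecker

lemma stmt12_left_inv {K : Type*} [Field K] {a r : ℕ} (M : Matrix (Fin a) (Fin r) K)
    (hM : M.rank = r) : ∃ C : Matrix (Fin r) (Fin a) K, C * M = 1 := by
  have h1 := LinearMap.finrank_range_add_finrank_ker M.mulVecLin
  have h2 : Module.finrank K (LinearMap.range M.mulVecLin) = r := hM
  rw [h2, Module.finrank_fin_fun] at h1
  have h3 : Module.finrank K (LinearMap.ker M.mulVecLin) = 0 := by omega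
  have h4 : LinearMap.ker M.mulVecLin = ⊥ := Submodule.finrank_eq_zero.mp h3
  obtain ⟨g, hg⟩ := LinearMap.exists_leftInverse_of_injective _ h4
  refine ⟨LinearMap.toMatrix' g, ?_⟩
  have := congrArg LinearMap.toMatrix' hg
  rw [LinearMap.toMatrix'_comp, LinearMap.toMatrix'_id] at this
  simpa [← Matrix.toLin'_apply'] using this

lemma stmt12_key {O K : Type*} [CommRing O] [IsDomain O] [IsPrincipalIdealRing O]
    [Field K] [Algebra O K] [IsFractionRing O K] {a r : ℕ}
    (M : Matrix (Fin a) (Fin r) K) (hM : M.rank = r) :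
    ∃ (n : ℕ) (Q : Matrix (Fin r) (Fin n) K) (B : Matrix (Fin n) (Fin a) O)
      (A : Matrix (Fin a) (Fin n) O),
      Q * (B.map (algebraMap O K) * M) = 1 ∧ M * Q = A.map (algebraMap O K) := by
  classical
  obtain ⟨C, hC⟩ := stmt12_left_inv M hM
  let N : Submodule O (Fin r → K) := Submodule.span O (Set.range M.row)
  have : Module.Finite O N := Module.Finite.span_of_finite O (Set.finite_range _)
  have : Module.IsTorsionFree O K := inferInstance
  have : Module.IsTorsionFree O N := inferInstance
  obtain ⟨n, b⟩ : Σ n, Module.Basis (Fin n) O N := Module.basisOfFiniteTypeTorsionFree'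
  let P : Matrix (Fin n) (Fin r) K := fun k => (b k : Fin r → K)
  have hB : ∀ k, ∃ c : Fin a → O, ∑ i, c i • M.row i = P k := fun k =>
    (Submodule.mem_span_range_iff_exists_fun O).mp (b k).2
  choose B hB using hB
  have hrow : ∀ i, M.row i ∈ N := fun i => Submodule.subset_span ⟨i, rfl⟩
  let A : Matrix (Fin a) (Fin n) O := fun i k => b.repr ⟨M.row i, hrow i⟩ k
  have hP : (Matrix.of B).map (algebraMap O K) * M = P := by
    ext k j
    rw [← hB k]
    simp [Matrix.mul_apply, Algebra.smul_def, Matrix.row]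
  have hA : A.map (algebraMap O K) * P = M := by
    ext i j
    have := congrArg (fun z : N => (z : Fin r → K) j) (b.sum_repr ⟨M.row i, hrow i⟩)
    simp only [Submodule.coe_sum, Finset.sum_apply, Submodule.coe_smul, Pi.smul_apply] at this
    rw [Matrix.mul_apply]
    simp only [Algebra.smul_def] at this
    exact this
  have hli : LinearIndependent K P := by
    rw [← LinearIndependent.iff_fractionRing (R := O)]
    exact b.linearIndependent.map' N.subtype (Submodule.ker_subtype N)
  have hQP : (C * A.map (algebraMap O K)) * P = 1 := by
    rw [Matrix.mul_assoc, hA, hC]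
  have hPQ : P * (C * A.map (algebraMap O K)) = 1 := by
    have h0 : (P * (C * A.map (algebraMap O K))) * P = (1 : Matrix (Fin n) (Fin n) K) * P := by
      rw [Matrix.mul_assoc, hQP, Matrix.mul_one, Matrix.one_mul]
    have hinj : Function.Injective P.vecMul := Matrix.vecMul_injective_iff.mpr hli
    ext k l
    have h1 := congrFun (congrArg Matrix.row h0) k
    exact congrFun (@hinj ((P * (C * A.map (algebraMap O K))) k)
      ((1 : Matrix (Fin n) (Fin n) K) k) h1) l
  refine ⟨n, C * A.map (algebraMap O K), Matrix.of B, A, ?_, ?_⟩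
  · rw [hP, hQP]
  · conv_lhs => rw [← hA]
    rw [Matrix.mul_assoc, hPQ, Matrix.mul_one]

/-- Matrix form of `𝔄_H = 𝔄_{H₁} ⊗_{O_K} 𝔄_{H̄}`: with `M₁` of rank `r` and `M₂`
of rank `u`, the lattice `Λ = {x : (M₁ ⊗ M₂)·x integral}` equals the
`O_K`-submodule generated by the elementary tensors `v ⊗ w` with `M₁·v` and
`M₂·w` integral. -/
theorem stmt12 {O_K K : Type*} [CommRing O_K] [IsDomain O_K] [IsPrincipalIdealRing O_K]
    [Field K] [Algebra O_K K] [IsFractionRing O_K K]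
    {a r b u : ℕ}
    (M₁ : Matrix (Fin a) (Fin r) K) (hM₁ : M₁.rank = r)
    (M₂ : Matrix (Fin b) (Fin u) K) (hM₂ : M₂.rank = u)
    (x : Fin r × Fin u → K) :
    (∀ p : Fin a × Fin b, ∃ c : O_K, algebraMap O_K K c = (M₁ ⊗ₖ M₂).mulVec x p) ↔
      x ∈ Submodule.span O_K {y : Fin r × Fin u → K |
        ∃ v : Fin r → K, ∃ w : Fin u → K,
          (∀ i : Fin a, ∃ c : O_K, algebraMap O_K K c = M₁.mulVec v i) ∧
          (∀ k : Fin b, ∃ c : O_K, algebraMap O_K K c = M₂.mulVec w k) ∧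
          y = fun p => v p.1 * w p.2} := by
  classical
  constructor
  · intro h
    choose c hc using h
    obtain ⟨n₁, Q₁, B₁, A₁, h₁, h₁'⟩ := stmt12_key (O := O_K) M₁ hM₁
    obtain ⟨n₂, Q₂, B₂, A₂, h₂, h₂'⟩ := stmt12_key (O := O_K) M₂ hM₂
    let z : Fin n₁ × Fin n₂ → O_K := (B₁ ⊗ₖ B₂).mulVec c
    have hx : x = (Q₁ ⊗ₖ Q₂).mulVec (fun p => algebraMap O_K K (z p)) := by
      have hz : (fun p => algebraMap O_K K (z p)) =
          ((B₁.map (algebraMap O_K K)) ⊗ₖ (B₂.map (algebraMap O_K K))).mulVec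
            ((M₁ ⊗ₖ M₂).mulVec x) := by
        funext p
        simp only [z, Matrix.mulVec, dotProduct, map_sum, map_mul]
        refine Finset.sum_congr rfl fun q _ => ?_
        rw [hc q]
        simp [Matrix.mulVec, dotProduct]
      rw [hz, Matrix.mulVec_mulVec, Matrix.mulVec_mulVec, ← Matrix.mul_kronecker_mul,
        ← Matrix.mul_kronecker_mul, Matrix.mul_assoc, h₁, Matrix.mul_assoc, h₂, Matrix.one_kronecker_one, Matrix.one_mulVec]
    have hx2 : x = ∑ q, z q • (fun p : Fin r × Fin u => Q₁ p.1 q.1 * Q₂ p.2 q.2) := by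
      conv_lhs => rw [hx]
      funext p
      simp [Matrix.mulVec, dotProduct, Algebra.smul_def, mul_comm]
    rw [hx2]
    refine Submodule.sum_mem _ fun q _ => Submodule.smul_mem _ _ (Submodule.subset_span ?_)
    refine ⟨fun j => Q₁ j q.1, fun l => Q₂ l q.2, fun i => ⟨A₁ i q.1, ?_⟩,
      fun k => ⟨A₂ k q.2, ?_⟩, rfl⟩
    · exact (congrFun (congrFun h₁' i) q.1).symm
    · exact (congrFun (congrFun h₂' k) q.2).symm
  · intro h
    induction h using Submodule.span_induction with
    | mem y hy =>
      obtain ⟨v, w, hv, hw, rfl⟩ := hy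
      intro p
      obtain ⟨c, hc⟩ := hv p.1
      obtain ⟨d, hd⟩ := hw p.2
      refine ⟨c * d, ?_⟩
      rw [map_mul, hc, hd]
      simp only [Matrix.mulVec, dotProduct, Fintype.sum_prod_type, Finset.sum_mul_sum,
        Matrix.kroneckerMap_apply]
      exact Finset.sum_congr rfl fun _ _ => Finset.sum_congr rfl fun _ _ => by ring
    | zero => exact fun p => ⟨0, by simp⟩
    | add y y' _ _ hy hy' =>
      intro p
      obtain ⟨c, hc⟩ := hy p
      obtain ⟨d, hd⟩ := hy' p
      exact ⟨c + d, by rw [map_add, hc, hd, Matrix.mulVec_add, Pi.add_apply]⟩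
    | smul t y _ hy =>
      intro p
      obtain ⟨c, hc⟩ := hy p
      exact ⟨t * c, by rw [map_mul, hc, Matrix.mulVec_smul, Pi.smul_apply, Algebra.smul_def]⟩
end
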